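/- Consider the M-FSIG with N users and K = N channels, with fixed squared gains satisfying g_{m,n,k} > 0 for all m, n, k, powers P_n > 0, noise power N_0 > 0, and 1 ≤ M ≤ N. Then every bijection a : {1,…,N} → {1,…,N} with a_n ∈ M_n for all users n is a pure Nash equilibrium of the M-FSIG. -/

import Mathlib

open scoped Classical
/-- `orderStat Y i` is the i-th smallest value (1-indexed) among `Y 0, …, Y (N-1)`. -/
noncomputable def orderStat {N : ℕ} (Y : Fin N → ℝ) (i : ℕ) : ℝ :=
  ((List.ofFn Y).mergeSort (· ≤ ·)).getD (i - 1) 0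

/-- Interference experienced by user `n` on channel `k` under profile `a`. -/
noncomputable def interf {N : ℕ} (g : Fin N → Fin N → Fin N → ℝ) (P : Fin N → ℝ)
    (n k : Fin N) (a : Fin N → Fin N) : ℝ :=
  ∑ m ∈ Finset.univ.filter (fun m => m ≠ n ∧ a m = k), g m n k * P m

/-- `k` belongs to `M_n`, the set of user `n`'s `M` best channels. -/
def inBestM {N : ℕ} (g : Fin N → Fin N → Fin N → ℝ) (M : ℕ) (n k : Fin N) : Prop :=
  orderStat (fun j => g n n j) (N - M + 1) ≤ g n n k

/-- Utility of user `n` in the M-FSIG. -/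

noncomputable def mUtil {N : ℕ} (g : Fin N → Fin N → Fin N → ℝ) (P : Fin N → ℝ)
    (N0 : ℝ) (M : ℕ) (n : Fin N) (a : Fin N → Fin N) : ℝ :=
  if inBestM g M n (a n) then
    Real.logb 2 (1 + P n * orderStat (fun j => g n n j) (N - M + 1) /
      (N0 + interf g P n (a n) a))
  else 0

/-- Pure Nash equilibrium of the M-FSIG. -/
def isMPNE {N : ℕ} (g : Fin N → Fin N → Fin N → ℝ) (P : Fin N → ℝ) (N0 : ℝ) (M : ℕ)
    (a : Fin N → Fin N) : Prop :=
  ∀ n b, mUtil g P N0 M n (Function.update a n b) ≤ mUtil g P N0 M n a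

theorem orderStat_nonneg {N : ℕ} (Y : Fin N → ℝ) (hY : ∀ j, 0 ≤ Y j) (i : ℕ) :
    0 ≤ orderStat Y i := by
  unfold orderStat
  rw [List.getD_eq_getElem?_getD]
  rcases h : ((List.ofFn Y).mergeSort (· ≤ ·))[i - 1]? with _ | x
  · simp
  · have hx := List.mem_of_getElem? h
    rw [List.mem_mergeSort, List.mem_ofFn] at hx
    obtain ⟨j, rfl⟩ := hx
    exact hY j

theorem interf_nonneg {N : ℕ} (g : Fin N → Fin N → Fin N → ℝ) (P : Fin N → ℝ)
    (hg : ∀ m n k, 0 ≤ g m n k) (hP : ∀ n, 0 ≤ P n) (n k : Fin N) (a : Fin N → Fin N) :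
    0 ≤ interf g P n k a :=
  Finset.sum_nonneg fun m _ => mul_nonneg (hg m n k) (hP m)

theorem interf_self_eq_zero_of_injective {N : ℕ} (g : Fin N → Fin N → Fin N → ℝ)
    (P : Fin N → ℝ) (n : Fin N) {a : Fin N → Fin N} (ha : Function.Injective a) :
    interf g P n (a n) a = 0 := by
  refine Finset.sum_eq_zero fun m hm => ?_
  obtain ⟨hne, heq⟩ := (Finset.mem_filter.mp hm).2
  exact absurd (ha heq) hne

/-- In the M-FSIG with positive gains, every bijection of users to channels assigning
each user one of his `M` best channels is a pure Nash equilibrium. -/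
theorem stmt12 {N : ℕ} (g : Fin N → Fin N → Fin N → ℝ) (P : Fin N → ℝ) (N0 : ℝ) (M : ℕ)
    (hg : ∀ m n k, 0 < g m n k) (hP : ∀ n, 0 < P n) (hN0 : 0 < N0)
    (hM1 : 1 ≤ M) (hMN : M ≤ N)
    (a : Fin N → Fin N) (hbij : Function.Bijective a)
    (hbest : ∀ n, inBestM g M n (a n)) :
    isMPNE g P N0 M a := by
  intro n b
  have hS : 0 ≤ P n * orderStat (fun j => g n n j) (N - M + 1) :=
    mul_nonneg (hP n).le (orderStat_nonneg _ (fun j => (hg n n j).le) _)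
  have hI : ∀ k c, 0 ≤ interf g P n k c :=
    interf_nonneg g P (fun m n k => (hg m n k).le) (fun n => (hP n).le) n
  unfold mUtil
  rw [if_pos (hbest n), interf_self_eq_zero_of_injective g P n hbij.injective, add_zero]
  split_ifs
  · have hI' := hI (Function.update a n b n) (Function.update a n b)
    refine Real.logb_le_logb_of_le one_lt_two (by positivity) ?_
    gcongr
    linarith
  · exact Real.logb_nonneg one_lt_two (le_add_of_nonneg_right (by positivity))
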